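/- Let p ≥ 1, let G be an α-critical finite simple graph on n vertices with G ∈ W_p, let r = α(G) ≥ 2, and let H be the complement of G. Then the number of edges of H satisfies e(H) ≥ (r−1)n − r(r−1)/2 and e(H) ≥ ⌈n·p·(r−1)/2⌉. -/

import Mathlib

open Finset
open scoped Classical

/-- `S` is an independent set of the graph `G`. -/
def IsIndep {V : Type*} (G : SimpleGraph V) (S : Finset V) : Prop :=
  ∀ ⦃x⦄, x ∈ S → ∀ ⦃y⦄, y ∈ S → x ≠ y → ¬ G.Adj x y

/-- The independence number `α(G)` of a finite graph `G`. -/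
noncomputable def alpha {V : Type*} [Fintype V] (G : SimpleGraph V) : ℕ :=
  Finset.univ.sup fun S : Finset V => if IsIndep G S then S.card else 0

/-- `S` is a maximum independent set of `G`. -/
def IsMaxIndep {V : Type*} [Fintype V] (G : SimpleGraph V) (S : Finset V) : Prop :=
  IsIndep G S ∧ S.card = alpha G

/-- `S` is a maximal (inclusion-wise) independent set of `G`. -/
def IsMaximalIndep {V : Type*} [DecidableEq V] (G : SimpleGraph V) (S : Finset V) : Prop :=
  IsIndep G S ∧ ∀ x, x ∉ S → ¬ IsIndep G (insert x S)

/-- `G` is well-covered: every maximal independent set has cardinality `α(G)`. -/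
def WellCovered {V : Type*} [Fintype V] [DecidableEq V] (G : SimpleGraph V) : Prop :=
  ∀ S : Finset V, IsMaximalIndep G S → S.card = alpha G

/-- `G ∈ W_p`: `|V(G)| ≥ p` and every `p` pairwise disjoint independent sets extend to
`p` pairwise disjoint maximum independent sets. -/
def MemW {V : Type*} [Fintype V] (G : SimpleGraph V) (p : ℕ) : Prop :=
  p ≤ Fintype.card V ∧
    ∀ A : Fin p → Finset V, (∀ i, IsIndep G (A i)) →
      (∀ i j, i ≠ j → Disjoint (A i) (A j)) →
      ∃ M : Fin p → Finset V, (∀ i, IsMaxIndep G (M i)) ∧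
        (∀ i j, i ≠ j → Disjoint (M i) (M j)) ∧ ∀ i, A i ⊆ M i

/-- The `W`-index of `G`: the largest `p` with `G ∈ W_p`. -/
noncomputable def wIndex {V : Type*} [Fintype V] (G : SimpleGraph V) : ℕ :=
  sSup {p : ℕ | MemW G p}

/-- The fiber `F_G(S)`: the vertices `x ∉ S` with `S ∪ {x}` a maximum independent set. -/
noncomputable def fiber {V : Type*} [Fintype V] [DecidableEq V]
    (G : SimpleGraph V) (S : Finset V) : Finset V :=
  Finset.univ.filter fun x => x ∉ S ∧ IsMaxIndep G (insert x S)

/-- `G` is `α`-critical: deleting any edge increases the independence number. -/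
def AlphaCritical {V : Type*} [Fintype V] (G : SimpleGraph V) : Prop :=
  ∀ x y, G.Adj x y → alpha G < alpha (G.deleteEdges {s(x, y)})

/-- `H` is `K_t`-saturated: `H` is `K_t`-free but adding any missing edge creates a `K_t`. -/
def KSaturated {V : Type*} [Fintype V] (H : SimpleGraph V) (t : ℕ) : Prop :=
  (∀ Q : Finset V, ¬ H.IsNClique t Q) ∧
    ∀ x y : V, x ≠ y → ¬ H.Adj x y →
      ∃ Q : Finset V, (H ⊔ SimpleGraph.fromEdgeSet {s(x, y)}).IsNClique t Q

/-- `Q` is an inclusion-maximal clique of `H`. -/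
def IsMaximalClique {V : Type*} [DecidableEq V] (H : SimpleGraph V) (Q : Finset V) : Prop :=
  H.IsClique (Q : Set V) ∧ ∀ x, x ∉ Q → ¬ H.IsClique ((insert x Q : Finset V) : Set V)

/-- The `(r-1)`-clique-codegree of `Q` in `H`: the number of vertices extending `Q`
to an `r`-clique of `H`. -/
noncomputable def codeg {V : Type*} [Fintype V] [DecidableEq V]
    (H : SimpleGraph V) (r : ℕ) (Q : Finset V) : ℕ :=
  (Finset.univ.filter fun x => x ∉ Q ∧ H.IsNClique r (insert x Q)).card

/-- The minimum `(r-1)`-clique-codegree `δ^cl_{r-1}(H)`. -/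
noncomputable def minCliqueCodeg {V : Type*} [Fintype V] [DecidableEq V]
    (H : SimpleGraph V) (r : ℕ) : ℕ :=
  sInf {m : ℕ | ∃ Q : Finset V, H.IsNClique (r - 1) Q ∧ codeg H r Q = m}

/-- The vertex set of the localization `G_S = G - N_G[S]`. -/
noncomputable def localVerts {V : Type*} [Fintype V] (G : SimpleGraph V) (S : Finset V) :
    Finset V :=
  Finset.univ.filter fun v => v ∉ S ∧ ∀ s ∈ S, ¬ G.Adj s v

/-- The localization `G_S = G - N_G[S]`, as an induced subgraph. -/
noncomputable def localize {V : Type*} [Fintype V] (G : SimpleGraph V) (S : Finset V) :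
    SimpleGraph {v : V // v ∈ localVerts G S} :=
  SimpleGraph.comap (fun v => (v : V)) G

/-- The vertex set of the edge-localization `G_{ab} = G - (N_G(a) ∪ N_G(b))`. -/
noncomputable def edgeVerts {V : Type*} [Fintype V] (G : SimpleGraph V) (a b : V) : Finset V :=
  Finset.univ.filter fun v => ¬ G.Adj a v ∧ ¬ G.Adj b v

/-- The edge-localization `G_{ab} = G - (N_G(a) ∪ N_G(b))`, as an induced subgraph. -/
noncomputable def edgeLocalize {V : Type*} [Fintype V] (G : SimpleGraph V) (a b : V) :
    SimpleGraph {v : V // v ∈ edgeVerts G a b} :=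
  SimpleGraph.comap (fun v => (v : V)) G

/-- The **Bollobás set-pair inequality**. -/
theorem sum_inv_choose_le_one_of_cross_intersecting {ι V : Type*}
    (s : Finset ι) (A : ι → Finset V) (B : ι → Finset V) (X : Finset V)
    (hA : ∀ i ∈ s, A i ⊆ X) (hB : ∀ i ∈ s, B i ⊆ X)
    (hdisj : ∀ i ∈ s, Disjoint (A i) (B i))
    (hcross : ∀ i ∈ s, ∀ j ∈ s, i ≠ j → ¬ Disjoint (A i) (B j)) :
    ∑ i ∈ s, (1 : ℚ) / ((#(A i) + #(B i)).choose #(A i)) ≤ 1 := by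
  obtain ⟨n, hn⟩ : ∃ n, #X = n := ⟨_, rfl⟩
  induction n generalizing s B X with
  | zero =>
    obtain rfl := Finset.card_eq_zero.mp hn
    have hs : #s ≤ 1 := Finset.card_le_one.mpr fun i hi j hj => by
      by_contra hij
      exact hcross i hi j hj hij (by simp [Finset.subset_empty.mp (hA i hi)])
    have : ∀ i ∈ s, (1 : ℚ) / ((#(A i) + #(B i)).choose #(A i)) = 1 := fun i hi => by
      simp [Finset.subset_empty.mp (hA i hi)]
    rw [Finset.sum_congr rfl this]
    simpa using hs
  | succ n ih =>
    by_cases hempty : ∃ i ∈ s, B i = ∅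
    · obtain ⟨i, hi, hBi⟩ := hempty
      have hs : s = {i} := Finset.eq_singleton_iff_unique_mem.mpr ⟨hi, fun j hj => by
        by_contra hji
        exact hcross j hj i hi hji (by simp [hBi])⟩
      simp [hs, hBi]
    push Not at hempty
    have step : ∀ x ∈ X,
        ∑ i ∈ s with x ∉ A i, (1 : ℚ) / ((#(A i) + #((B i).erase x)).choose #(A i)) ≤ 1 := by
      intro x hx
      refine ih _ (fun i => (B i).erase x) (X.erase x) ?_ ?_ ?_ ?_ ?_
      · intro i hi
        rw [Finset.mem_filter] at hi
        exact Finset.subset_erase.mpr ⟨hA i hi.1, hi.2⟩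
      · intro i hi
        exact Finset.erase_subset_erase x (hB i (Finset.mem_filter.mp hi).1)
      · intro i hi
        exact (hdisj i (Finset.mem_filter.mp hi).1).mono_right (Finset.erase_subset _ _)
      · intro i hi j hj hij hd
        rw [Finset.mem_filter] at hi hj
        obtain ⟨y, hy, hy'⟩ := Finset.not_disjoint_iff.mp (hcross i hi.1 j hj.1 hij)
        exact Finset.disjoint_left.mp hd hy
          (Finset.mem_erase.mpr ⟨fun h => hi.2 (h ▸ hy), hy'⟩)
      · rw [Finset.card_erase_of_mem hx, hn, Nat.add_sub_cancel]
    have weight : ∀ i ∈ s,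
        ∑ x ∈ X with x ∉ A i, (1 : ℚ) / ((#(A i) + #((B i).erase x)).choose #(A i)) =
          (n + 1) * (1 / ((#(A i) + #(B i)).choose #(A i))) := by
      intro i hi
      obtain ⟨b, hb⟩ : ∃ b, #(B i) = b + 1 :=
        Nat.exists_eq_succ_of_ne_zero (Finset.card_ne_zero.mpr (hempty i hi))
      have hsplit : X.filter (fun x => x ∉ A i) = B i ∪ (X \ (A i ∪ B i)) := by
        ext x
        have h1 := @hB i hi x
        have h2 : x ∈ B i → x ∉ A i := fun h => Finset.disjoint_right.mp (hdisj i hi) h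
        simp only [Finset.mem_filter, Finset.mem_union, Finset.mem_sdiff]
        tauto
      have hrest : #(X \ (A i ∪ B i)) + (#(A i) + #(B i)) = n + 1 := by
        rw [← Finset.card_union_of_disjoint (hdisj i hi), ← hn]
        exact Finset.card_sdiff_add_card_eq_card (Finset.union_subset (hA i hi) (hB i hi))
      rw [hsplit, Finset.sum_union (Finset.disjoint_left.mpr fun x hx hx' => by
        simp [hx] at hx')]
      have e1 : ∀ x ∈ B i, (1 : ℚ) / ((#(A i) + #((B i).erase x)).choose #(A i)) =
          1 / ((#(A i) + b).choose #(A i)) := fun x hx => by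
        rw [Finset.card_erase_of_mem hx, hb, Nat.add_sub_cancel]
      have e2 : ∀ x ∈ X \ (A i ∪ B i),
          (1 : ℚ) / ((#(A i) + #((B i).erase x)).choose #(A i)) =
          1 / ((#(A i) + (b + 1)).choose #(A i)) := fun x hx => by
        rw [Finset.erase_eq_of_notMem (by
          simp only [Finset.mem_sdiff, Finset.mem_union] at hx; tauto), hb]
      rw [Finset.sum_congr rfl e1, Finset.sum_congr rfl e2, Finset.sum_const, Finset.sum_const,
        hb, nsmul_eq_mul, nsmul_eq_mul]
      have hchoose := Nat.choose_mul_succ_eq (#(A i) + b) #(A i)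
      rw [show #(A i) + b + 1 - #(A i) = b + 1 by omega, add_assoc] at hchoose
      have p1 : (0 : ℚ) < (#(A i) + b).choose #(A i) := by
        exact_mod_cast Nat.choose_pos (Nat.le_add_right _ _)
      have p2 : (0 : ℚ) < (#(A i) + (b + 1)).choose #(A i) := by
        exact_mod_cast Nat.choose_pos (Nat.le_add_right _ _)
      have hq : ((#(A i) + b).choose #(A i) : ℚ) * (#(A i) + (b + 1)) =
          (#(A i) + (b + 1)).choose #(A i) * (b + 1) := by exact_mod_cast hchoose
      have hr : (#(X \ (A i ∪ B i)) : ℚ) + (#(A i) + (b + 1)) = n + 1 := by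
        rw [hb] at hrest; exact_mod_cast hrest
      rw [← hr]
      push_cast
      field_simp
      linear_combination -hq
    have key := Finset.sum_le_sum step
    have swap : ∑ x ∈ X, ∑ i ∈ s with x ∉ A i,
          (1 : ℚ) / ((#(A i) + #((B i).erase x)).choose #(A i)) =
        ∑ i ∈ s, ∑ x ∈ X with x ∉ A i,
          (1 : ℚ) / ((#(A i) + #((B i).erase x)).choose #(A i)) :=
      Finset.sum_comm' (by simp; tauto)
    rw [swap, Finset.sum_congr rfl weight, ← Finset.mul_sum, Finset.sum_const, hn, nsmul_eq_mul,
      mul_one] at key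
    push_cast at key
    have hpos : (0 : ℚ) < n + 1 := by positivity
    exact le_of_mul_le_mul_left (by linarith) hpos

theorem IsIndep.mono {V : Type*} {G : SimpleGraph V} {S T : Finset V} (hT : IsIndep G T)
    (h : S ⊆ T) : IsIndep G S :=
  fun _ hx _ hy => hT (h hx) (h hy)

theorem IsIndep.card_le_alpha {V : Type*} [Fintype V] {G : SimpleGraph V} {S : Finset V}
    (hS : IsIndep G S) : #S ≤ alpha G := by
  have h := Finset.le_sup (f := fun S : Finset V => if IsIndep G S then #S else 0)
    (Finset.mem_univ S)
  rwa [if_pos hS] at h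

theorem exists_isMaxIndep {V : Type*} [Fintype V] (G : SimpleGraph V) :
    ∃ S, IsMaxIndep G S := by
  obtain ⟨S, -, hS⟩ := Finset.exists_mem_eq_sup (Finset.univ : Finset (Finset V))
    Finset.univ_nonempty fun S : Finset V => if IsIndep G S then #S else 0
  by_cases h : IsIndep G S
  · exact ⟨S, h, by rw [alpha, hS, if_pos h]⟩
  · refine ⟨∅, by simp [IsIndep], ?_⟩
    rw [alpha, hS, if_neg h, Finset.card_empty]

/-- An `α`-critical edge `xy` is the only edge inside some set of `α(G) + 1` vertices. -/
theorem AlphaCritical.exists_card_eq {V : Type*} [Fintype V] [DecidableEq V] {G : SimpleGraph V}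
    (hG : AlphaCritical G) {e : Sym2 V} (he : e ∈ G.edgeSet) :
    ∃ S : Finset V, #S = alpha G + 1 ∧ e.toFinset ⊆ S ∧
      ∀ f ∈ G.edgeSet, f.toFinset ⊆ S → f = e := by
  induction e with | _ x y
  have hxy : G.Adj x y := he
  obtain ⟨T, hT, hTcard⟩ := exists_isMaxIndep (G.deleteEdges {s(x, y)})
  have hlt := hG x y hxy
  rw [← hTcard] at hlt
  obtain ⟨S, hST, hS⟩ := Finset.exists_subset_card_eq (Nat.succ_le_of_lt hlt)
  have huniq : ∀ f ∈ G.edgeSet, f.toFinset ⊆ S → f = s(x, y) := by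
    intro f hf hfS
    induction f with | _ u v
    by_contra hne
    have hu : u ∈ S := hfS (by simp)
    have hv : v ∈ S := hfS (by simp)
    have huv : G.Adj u v := hf
    exact hT (hST hu) (hST hv) huv.ne (by
      rw [SimpleGraph.deleteEdges_adj]
      exact ⟨huv, hne⟩)
  refine ⟨S, hS, ?_, huniq⟩
  have hnot : ¬ IsIndep G S := fun h => by
    have := h.card_le_alpha
    omega
  simp only [IsIndep, not_forall, not_not] at hnot
  obtain ⟨u, hu, v, hv, -, huv⟩ := hnot
  have hsub : (s(u, v)).toFinset ⊆ S := by
    intro z hz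
    rcases (by simpa using hz : z = u ∨ z = v) with rfl | rfl <;> assumption
  exact huniq _ huv hsub ▸ hsub

/-- An `α`-critical graph on `n` vertices has at most `(n - α + 1).choose 2` edges. -/
theorem AlphaCritical.card_edgeFinset_le {V : Type*} [Fintype V] [DecidableEq V]
    {G : SimpleGraph V} [Fintype G.edgeSet] (hG : AlphaCritical G) :
    #G.edgeFinset ≤ (Fintype.card V - alpha G + 1).choose 2 := by
  choose! S hScard hSmem hSuniq using fun e (he : e ∈ G.edgeSet) => hG.exists_card_eq he
  have hb := sum_inv_choose_le_one_of_cross_intersecting G.edgeFinset Sym2.toFinset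
    (fun e => (S e)ᶜ) Finset.univ (by simp) (by simp)
    (fun e he => by
      rw [disjoint_compl_right_iff]
      exact hSmem e (SimpleGraph.mem_edgeFinset.mp he))
    (fun e he f hf hef => by
      rw [disjoint_compl_right_iff]
      exact fun h => hef (hSuniq f (SimpleGraph.mem_edgeFinset.mp hf) e
        (SimpleGraph.mem_edgeFinset.mp he) h))
  have hterm : ∀ e ∈ G.edgeFinset,
      (1 : ℚ) / ((#e.toFinset + #(S e)ᶜ).choose #e.toFinset) =
        1 / ((Fintype.card V - alpha G + 1).choose 2 : ℕ) := by
    intro e he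
    rw [SimpleGraph.mem_edgeFinset] at he
    have h2 : #e.toFinset = 2 := Sym2.card_toFinset_of_not_isDiag e (G.not_isDiag_of_mem_edgeSet he)
    have h3 := hScard e he
    have h4 := Finset.card_le_univ (S e)
    rw [h2, Finset.card_compl, show 2 + (Fintype.card V - #(S e)) =
      Fintype.card V - alpha G + 1 by omega]
  rw [Finset.sum_congr rfl hterm, Finset.sum_const, nsmul_eq_mul, mul_one_div] at hb
  rcases Nat.eq_zero_or_pos ((Fintype.card V - alpha G + 1).choose 2) with h0 | hpos
  · by_contra hlt
    have hne : G.edgeFinset.Nonempty := Finset.card_pos.mp (by omega)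
    obtain ⟨e, he⟩ := hne
    have h3 := hScard e (SimpleGraph.mem_edgeFinset.mp he)
    have h4 := Finset.card_le_univ (S e)
    rw [Nat.choose_eq_zero_iff] at h0
    omega
  · rw [div_le_one (by exact_mod_cast hpos)] at hb
    exact_mod_cast hb

/-- In a graph of `W_p`, every independent set of size `α(G) - 1` has at least `p` extensions
to a maximum independent set. -/
theorem MemW.le_card_fiber {V : Type*} [Fintype V] [DecidableEq V] {G : SimpleGraph V} {p : ℕ}
    (hW : MemW G p) {S : Finset V} (hS : IsIndep G S) (hcard : #S + 1 = alpha G) :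
    p ≤ #(fiber G S) := by
  by_contra! hlt
  obtain ⟨q, rfl⟩ : ∃ q, p = q + 1 := Nat.exists_eq_succ_of_ne_zero (by omega)
  set F := fiber G S with hF
  let A : Fin (q + 1) → Finset V := Fin.cons S fun i =>
    if h : (i : ℕ) < #F then {(F.equivFin.symm ⟨i, h⟩ : V)} else ∅
  have hAF : ∀ i : Fin q, A i.succ ⊆ F := by
    intro i
    simp only [A, Fin.cons_succ]
    split_ifs <;> simp
  have hSF : Disjoint S F := Finset.disjoint_left.mpr fun x hx hx' => by
    simp [hF, fiber, hx] at hx'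
  have hA0 : A 0 = S := rfl
  obtain ⟨M, hM, hMdisj, hAM⟩ := hW.2 A
    (fun i => by
      refine Fin.cases hS (fun i => ?_) i
      simp only [A, Fin.cons_succ]
      split_ifs <;> simp [IsIndep])
    (fun i j => by
      refine Fin.cases (Fin.cases (by simp) (fun j _ => ?_) j)
        (fun i => Fin.cases (fun _ => ?_) (fun j hij => ?_) j) i
      · exact hSF.mono_right (hAF j)
      · exact hSF.symm.mono_left (hAF i)
      · simp only [A, Fin.cons_succ]
        split_ifs
        · rw [Finset.disjoint_singleton]
          intro h
          have := F.equivFin.symm.injective (Subtype.ext h)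
          simp only [Fin.mk.injEq] at this
          exact hij (congrArg Fin.succ (Fin.ext this))
        all_goals simp)
  have hSM : S ⊆ M 0 := hA0 ▸ hAM 0
  obtain ⟨y, hy, hyS⟩ := Finset.exists_mem_notMem_of_card_lt_card
    (show #S < #(M 0) by rw [(hM 0).2]; omega)
  have hins : insert y S ⊆ M 0 := Finset.insert_subset hy hSM
  have hyF : y ∈ F := by
    simp only [hF, fiber, Finset.mem_filter, Finset.mem_univ, true_and]
    exact ⟨hyS, (hM 0).1.mono hins, by rw [Finset.card_insert_of_notMem hyS, hcard]⟩
  let k := F.equivFin ⟨y, hyF⟩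
  have hk : (k : ℕ) < q := by have := k.2; omega
  have hyM : y ∈ M (Fin.succ ⟨k, hk⟩) := hAM _ (by
    simp only [A, Fin.cons_succ]
    simp [k])
  exact Finset.disjoint_left.mp (hMdisj 0 _ (Fin.succ_ne_zero _).symm) hy hyM

/-- In a graph of `W_p`, every vertex has at least `p * (α(G) - 1)` non-neighbours. -/
theorem MemW.le_degree_compl {V : Type*} [Fintype V] [DecidableEq V] {G : SimpleGraph V} {p : ℕ}
    [DecidableRel Gᶜ.Adj] (hp : 1 ≤ p) (hW : MemW G p) (v : V) :
    p * (alpha G - 1) ≤ Gᶜ.degree v := by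
  obtain ⟨M, hM, -, hvM⟩ := hW.2 (fun i => if (i : ℕ) = 0 then {v} else ∅)
    (fun i => by split_ifs <;> simp [IsIndep])
    (fun i j hij => by
      split_ifs with hi hj
      · exact absurd (Fin.ext (hi.trans hj.symm)) hij
      all_goals simp)
  replace hM := hM ⟨0, hp⟩
  have hv : v ∈ M ⟨0, hp⟩ := hvM ⟨0, hp⟩ (by simp)
  set N := M ⟨0, hp⟩
  have hmem : ∀ {x y}, y ∈ fiber G (N.erase x) → ∀ z ∈ N, z ≠ x → z ≠ y ∧ ¬ G.Adj z y := by
    intro x y hy z hz hzx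
    simp only [fiber, Finset.mem_filter, Finset.mem_univ, true_and] at hy
    have hz' : z ∈ N.erase x := Finset.mem_erase.mpr ⟨hzx, hz⟩
    have hzy : z ≠ y := fun h => hy.1 (h ▸ hz')
    exact ⟨hzy, hy.2.1 (Finset.mem_insert_of_mem hz') (Finset.mem_insert_self _ _) hzy⟩
  have hdisj : ((N.erase v : Finset V) : Set V).PairwiseDisjoint
      fun x => fiber G (N.erase x) := by
    intro x hx x' hx' hne
    refine Finset.disjoint_left.mpr fun y hy hy' => ?_
    have hall : ∀ z ∈ N, z ≠ y ∧ ¬ G.Adj z y := fun z hz => by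
      by_cases h : z = x
      · exact hmem hy' z hz (h ▸ hne)
      · exact hmem hy z hz h
    have hyN : y ∉ N := fun h => (hall y h).1 rfl
    have hind : IsIndep G (insert y N) := by
      intro a ha b hb hab
      rcases Finset.mem_insert.mp ha with rfl | haN <;>
        rcases Finset.mem_insert.mp hb with rfl | hbN
      · exact absurd rfl hab
      · exact fun h => (hall b hbN).2 h.symm
      · exact (hall a haN).2
      · exact hM.1 haN hbN hab
    have := hind.card_le_alpha
    rw [Finset.card_insert_of_notMem hyN, hM.2] at this
    omega
  calc p * (alpha G - 1) = ∑ x ∈ N.erase v, p := by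
        rw [Finset.sum_const, Finset.card_erase_of_mem hv, hM.2, smul_eq_mul, mul_comm]
    _ ≤ ∑ x ∈ N.erase v, #(fiber G (N.erase x)) := Finset.sum_le_sum fun x hx => by
        have hx := Finset.mem_of_mem_erase hx
        exact hW.le_card_fiber (hM.1.mono (Finset.erase_subset _ _))
          (by rw [Finset.card_erase_add_one hx, hM.2])
    _ = #((N.erase v).biUnion fun x => fiber G (N.erase x)) :=
        (Finset.card_biUnion hdisj).symm
    _ ≤ Gᶜ.degree v := Finset.card_le_card fun y hy => by
        obtain ⟨x, hx, hy⟩ := Finset.mem_biUnion.mp hy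
        rw [SimpleGraph.mem_neighborFinset, SimpleGraph.compl_adj]
        exact hmem hy v hv (Finset.ne_of_mem_erase hx).symm

theorem card_edgeFinset_add_card_edgeFinset_compl {V : Type*} [Fintype V] [DecidableEq V]
    (G : SimpleGraph V) [Fintype G.edgeSet] [Fintype Gᶜ.edgeSet] :
    #G.edgeFinset + #Gᶜ.edgeFinset = (Fintype.card V).choose 2 := by
  rw [← Finset.card_union_of_disjoint
      (SimpleGraph.disjoint_edgeFinset.mpr disjoint_compl_right),
    ← SimpleGraph.card_edgeFinset_top_eq_card_choose_two (V := V)]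
  congr 1
  ext e
  induction e with | _ x y
  have := @SimpleGraph.Adj.ne V G x y
  simp only [Finset.mem_union, SimpleGraph.mem_edgeFinset, SimpleGraph.mem_edgeSet,
    SimpleGraph.compl_adj, SimpleGraph.top_adj]
  tauto

/-- A `p`-sensitive saturation edge bound. -/
theorem complement_edge_bounds {V : Type*} [Fintype V] [DecidableEq V]
    (G : SimpleGraph V) (p r : ℕ) (hp : 1 ≤ p)
    (hcrit : AlphaCritical G) (hW : MemW G p) (hr : 2 ≤ r) (halpha : alpha G = r) :
    ((r : ℤ) - 1) * (Fintype.card V : ℤ) - (r : ℤ) * ((r : ℤ) - 1) / 2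
        ≤ (Gᶜ.edgeFinset.card : ℤ) ∧
      ⌈(Fintype.card V : ℚ) * (p : ℚ) * ((r : ℚ) - 1) / 2⌉₊ ≤ Gᶜ.edgeFinset.card := by
  subst halpha
  constructor
  · have hle := hcrit.card_edgeFinset_le
    have hsum := card_edgeFinset_add_card_edgeFinset_compl G
    obtain ⟨S, hS⟩ := exists_isMaxIndep G
    have hn : alpha G ≤ Fintype.card V := hS.2 ▸ Finset.card_le_univ S
    obtain ⟨m, hm⟩ := Nat.exists_eq_add_of_le hn
    rw [hm, Nat.add_sub_cancel_left] at hle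
    rw [hm] at hsum ⊢
    generalize alpha G = r at *
    have hqle : (#G.edgeFinset : ℚ) ≤ ((m : ℚ) + 1) * m / 2 := by
      have : (#G.edgeFinset : ℚ) ≤ ((m + 1).choose 2 : ℕ) := by exact_mod_cast hle
      rw [Nat.cast_choose_two] at this
      push_cast at this
      linarith
    have hqsum : (#G.edgeFinset : ℚ) + #Gᶜ.edgeFinset = ((r : ℚ) + m) * (r + m - 1) / 2 := by
      have : (#G.edgeFinset : ℚ) + #Gᶜ.edgeFinset = ((r + m).choose 2 : ℕ) := by
        exact_mod_cast hsum
      rw [Nat.cast_choose_two] at this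
      push_cast at this
      linarith
    have hdvd : (2 : ℤ) ∣ (r : ℤ) * ((r : ℤ) - 1) := (Int.even_mul_pred_self _).two_dvd
    have hq : (((r : ℤ) * ((r : ℤ) - 1) / 2 : ℤ) : ℚ) = (r : ℚ) * ((r : ℚ) - 1) / 2 := by
      rw [Int.cast_div hdvd (by norm_num)]
      push_cast
      rfl
    rw [← Int.cast_le (R := ℚ), Int.cast_sub, hq]
    push_cast
    linarith
  · rw [Nat.ceil_le]
    have hdeg : Fintype.card V * (p * (alpha G - 1)) ≤ 2 * #Gᶜ.edgeFinset := by
      rw [← SimpleGraph.sum_degrees_eq_twice_card_edges]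
      calc _ = ∑ _v : V, p * (alpha G - 1) := by simp
        _ ≤ _ := Finset.sum_le_sum fun v _ => hW.le_degree_compl hp v
    have hq : (Fintype.card V : ℚ) * (p * ((alpha G : ℚ) - 1)) ≤ 2 * #Gᶜ.edgeFinset := by
      have : ((alpha G - 1 : ℕ) : ℚ) = alpha G - 1 := by
        rw [Nat.cast_sub (by omega), Nat.cast_one]
      rw [← this]
      exact_mod_cast hdeg
    linarith
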